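/- arXiv:1202.4032 — 3 statements merged into one kernel-verified Lean document; each statement's English description precedes it below -/
import Mathlib

section
/- If G is a finite tree, then the b-chromatic number of G equals m(G) or m(G) - 1. -/
open SimpleGraph Finset

/-- A vertex `u` is a b-vertex for the coloring `C` if `u` has a neighbor colored
with each color different from its own. -/
def IsBVertex {V : Type*} (G : SimpleGraph V) {k : ℕ} (C : V → Fin k) (u : V) : Prop :=
  ∀ j : Fin k, j ≠ C u → ∃ w, G.Adj u w ∧ C w = j

/-- A b-coloring of `G` with `k` colors: a proper coloring with colors `Fin k` such that
every color class contains a b-vertex (in particular every color is used). -/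
def IsBColoring {V : Type*} (G : SimpleGraph V) (k : ℕ) (C : V → Fin k) : Prop :=
  (∀ u v, G.Adj u v → C u ≠ C v) ∧
  (∀ i : Fin k, ∃ u, C u = i ∧ IsBVertex G C u)

/-- The b-chromatic number: the largest `k` such that `G` has a b-coloring with `k` colors. -/
noncomputable def bChromatic {V : Type*} (G : SimpleGraph V) : ℕ :=
  sSup {k : ℕ | ∃ C : V → Fin k, IsBColoring G k C}

/-- `m(G)`: the largest `k` such that `G` has at least `k` vertices of degree at least `k - 1`. -/
noncomputable def mParam {V : Type*} [Fintype V] (G : SimpleGraph V) [DecidableRel G.Adj] : ℕ :=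
  sSup {k : ℕ | k ≤ (Finset.univ.filter fun v => k - 1 ≤ G.degree v).card}

/-- The set `M(G)` of dense vertices, i.e. vertices of degree at least `m(G) - 1`. -/
noncomputable def denseSet {V : Type*} [Fintype V] (G : SimpleGraph V) [DecidableRel G.Adj] :
    Finset V :=
  Finset.univ.filter fun v => mParam G - 1 ≤ G.degree v

/-- `W` encircles `u` if every `v ∈ W` is adjacent to `u` or has a common neighbor
`w ∈ W` with `u` such that `deg w = m(G) - 1`. -/
def Encircles {V : Type*} [Fintype V] (G : SimpleGraph V) [DecidableRel G.Adj]
    (W : Finset V) (u : V) : Prop :=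
  ∀ v ∈ W, G.Adj u v ∨ ∃ w ∈ W, G.Adj v w ∧ G.Adj u w ∧ G.degree w = mParam G - 1

/-- A good set: a set `W ⊆ M(G)` of `m(G)` vertices that encircles no vertex outside `W`,
and such that every vertex outside `W` of degree at least `m(G)` has a neighbor in `W`. -/
def IsGoodSet {V : Type*} [Fintype V] (G : SimpleGraph V) [DecidableRel G.Adj]
    (W : Finset V) : Prop :=
  W.card = mParam G ∧
  (∀ v ∈ W, mParam G - 1 ≤ G.degree v) ∧
  (∀ u, u ∉ W → ¬ Encircles G W u) ∧
  (∀ x, x ∉ W → mParam G ≤ G.degree x → ∃ w ∈ W, G.Adj x w)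

/-- A tree rooted at `ρ` has a parent function and a depth function, and its edges are exactly
the pairs consisting of a non-root vertex and its parent. -/
lemma SimpleGraph.IsTree.exists_parent_depth {V : Type*} {G : SimpleGraph V} (hT : G.IsTree)
    (ρ : V) : ∃ (par : V → V) (d : V → ℕ), (∀ v, v ≠ ρ → d (par v) + 1 = d v) ∧
      (∀ v, v ≠ ρ → G.Adj v (par v)) ∧
      ∀ u v, G.Adj u v → (u ≠ ρ ∧ par u = v) ∨ (v ≠ ρ ∧ par v = u) := by
  choose P hP hlen using fun v => hT.connected.exists_path_of_dist v ρ
  have adj_snd : ∀ v, v ≠ ρ → G.Adj v (P v).snd := fun v hv =>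
    (P v).adj_snd (Walk.not_nil_of_ne hv)
  have key : ∀ u v, G.Adj u v → G.dist u ρ = G.dist v ρ + 1 → u ≠ ρ ∧ (P u).snd = v := by
    intro u v huv h
    have hne : u ≠ ρ := by
      rintro rfl
      simp at h
    refine ⟨hne, ?_⟩
    have hp : (Walk.cons huv (P v)).IsPath :=
      Walk.isPath_of_length_eq_dist _ (by simp [hlen, h])
    have := (hT.existsUnique_path u ρ).unique (hP u) hp
    rw [this]
    simp
  have step : ∀ u v, G.Adj u v → G.dist u ρ = G.dist v ρ + 1 ∨ G.dist v ρ = G.dist u ρ + 1 := by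
    intro u v huv
    have := hT.dist_eq_dist_add_one_of_adj ρ huv
    simpa only [dist_comm (u := ρ)] using this
  refine ⟨fun v => (P v).snd, fun v => G.dist v ρ, ?_, adj_snd, ?_⟩
  · intro v hv
    have hnil : ¬ (P v).Nil := Walk.not_nil_of_ne hv
    have h1 := (P v).length_tail_add_one hnil
    have h2 := dist_le (P v).tail
    have h3 := hlen v
    rcases step _ _ (adj_snd v hv) with h | h <;> dsimp only <;> omega
  · intro u v huv
    rcases step u v huv with h | h
    · exact Or.inl (key u v huv h)
    · exact Or.inr (key v u huv.symm h)

/-- Colors can be chosen top-down along a parent function: if every admissible color of the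
parent leaves an admissible different color for the child, there is an admissible coloring in
which every non-root vertex differs from its parent. -/
lemma exists_coloring_of_parent {V α : Type*} {ρ : V} {par : V → V} {d : V → ℕ}
    (hd : ∀ v, v ≠ ρ → d (par v) + 1 = d v) (P : V → α → Prop) (hρ : ∃ a, P ρ a)
    (hstep : ∀ v a, v ≠ ρ → P (par v) a → ∃ b, P v b ∧ a ≠ b) :
    ∃ C : V → α, ∀ v, P v (C v) ∧ (v ≠ ρ → C (par v) ≠ C v) := by
  classical
  obtain ⟨a₀, ha₀⟩ := hρ
  have : Nonempty α := ⟨a₀⟩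
  choose! g hg using hstep
  let C : V → α := (measure d).wf.fix fun v ih =>
    if h : v = ρ then a₀ else g v (ih (par v) (by have := hd v h; change d _ < d _; omega))
  have hC : ∀ v, C v = if v = ρ then a₀ else g v (C (par v)) := by
    intro v
    have := (measure d).wf.fix_eq (C := fun _ => α) (fun v ih =>
      if h : v = ρ then a₀ else g v (ih (par v) (by have := hd v h; change d _ < d _; omega))) v
    simpa [C] using this
  have hP : ∀ n v, d v = n → P v (C v) := by
    intro n
    induction n with
    | zero =>
      intro v hv
      have h : v = ρ := by
        by_contra h
        have := hd v h
        omega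
      rw [hC, if_pos h, h]
      exact ha₀
    | succ n ih =>
      intro v hv
      by_cases h : v = ρ
      · rw [hC, if_pos h, h]
        exact ha₀
      · rw [hC, if_neg h]
        have := hd v h
        exact (hg v _ h (ih _ (by omega))).1
  refine ⟨C, fun v => ⟨hP _ v rfl, fun h => ?_⟩⟩
  rw [hC v, if_neg h]
  exact (hg v _ h (hP _ _ rfl)).2

/-- The system of representatives used at a vertex `p` of `W`: the children of `p` outside `W`
can be colored so that, together with the neighbors of `p` in `W`, all colors are seen. -/
lemma exists_child_assignment {V : Type*} [Fintype V] {G : SimpleGraph V} [DecidableRel G.Adj]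
    {ρ : V} {par : V → V}
    (hadj : ∀ u v, G.Adj u v → (u ≠ ρ ∧ par u = v) ∨ (v ≠ ρ ∧ par v = u))
    {W : Finset V} (hdeg : ∀ w ∈ W, #W ≤ G.degree w)
    (henc : ∀ u, u ∉ W → ∃ w ∈ W, ¬ G.Adj u w) (hρ : ρ ∈ W) {p : V} (hp : p ∈ W) :
    ∃ f : V → V, (∀ x, x ∉ W → G.Adj p x → f x ∈ W ∧ f x ≠ p ∧ ¬ G.Adj x (f x)) ∧
      ∀ q ∈ W, q ≠ p → ¬ G.Adj p q → ∃ x, x ∉ W ∧ x ≠ ρ ∧ par x = p ∧ f x = q := by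
  classical
  set X : Finset V := univ.filter fun x => x ∉ W ∧ x ≠ ρ ∧ par x = p with hX
  set Q : Finset V := W.filter fun q => q ≠ p ∧ ¬ G.Adj p q with hQ
  have hQcard : #Q + #(W.filter fun q => G.Adj p q) + 1 = #W := by
    have h1 := card_filter_add_card_filter_not (s := W.erase p) (fun q => G.Adj p q)
    have h2 : (W.erase p).filter (fun q => ¬ G.Adj p q) = Q := by
      ext q; simp [hQ]; tauto
    have h3 : (W.erase p).filter (fun q => G.Adj p q) = W.filter fun q => G.Adj p q := by
      ext q
      simp only [mem_filter, mem_erase]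
      exact ⟨fun h => ⟨h.1.2, h.2⟩, fun h => ⟨⟨h.2.ne', h.1⟩, h.2⟩⟩
    rw [h2, h3] at h1
    have := card_erase_add_one hp
    omega
  have hXcard : #Q + 1 ≤ #X ∨ (#Q ≤ #X ∧ p ≠ ρ ∧ ρ ∈ Q) := by
    have hW := hdeg p hp
    rw [← card_neighborFinset_eq_degree] at hW
    by_cases h : p = ρ ∨ par p ∈ W
    · left
      have hsub : G.neighborFinset p ⊆ (W.filter fun q => G.Adj p q) ∪ X := by
        intro x hx
        rw [mem_neighborFinset] at hx
        have := hadj _ _ hx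
        simp only [hX, mem_union, mem_filter, mem_univ, true_and]
        grind
      have := (card_le_card hsub).trans (card_union_le _ _)
      omega
    · right
      rw [not_or] at h
      have hsub : G.neighborFinset p ⊆ insert (par p) ((W.filter fun q => G.Adj p q) ∪ X) := by
        intro x hx
        rw [mem_neighborFinset] at hx
        have := hadj _ _ hx
        simp only [hX, mem_insert, mem_union, mem_filter, mem_univ, true_and]
        grind
      have h1 := (card_le_card hsub).trans (card_insert_le _ _)
      have h2 := card_union_le (W.filter fun q => G.Adj p q) X
      refine ⟨by omega, h.1, ?_⟩
      simp only [hQ, mem_filter]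
      refine ⟨hρ, Ne.symm h.1, fun hc => ?_⟩
      rcases hadj _ _ hc with h' | h'
      · exact h.2 (h'.2 ▸ hρ)
      · exact h'.1 rfl
  have hchild : ∀ q ∈ Q, ∀ x ∈ X, G.Adj q x → q ≠ ρ ∧ par q = x := by
    intro q hq x hx hqx
    simp only [hQ, hX, mem_filter, mem_univ, true_and] at hq hx
    rcases hadj _ _ hqx with h | h
    · exact h
    · exact absurd (h.2.symm.trans hx.2.2) hq.2.1
  let t : Q → Finset V := fun q => X.filter fun x => ¬ G.Adj q x
  have hall : ∀ s : Finset Q, #s ≤ #(s.biUnion t) := by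
    intro s
    rcases s.eq_empty_or_nonempty with rfl | ⟨q, hq⟩
    · simp
    have hsQ : #s ≤ #Q := by simpa using card_le_univ s
    have hle : X.erase (par q) ⊆ s.biUnion t := by
      intro x hx
      rw [mem_erase] at hx
      refine mem_biUnion.2 ⟨q, hq, mem_filter.2 ⟨hx.2, fun h => hx.1 ?_⟩⟩
      exact (hchild q q.2 x hx.2 h).2.symm
    have h1 := card_le_card hle
    have h2 := pred_card_le_card_erase (s := X) (a := par q)
    rcases hXcard with h | ⟨h, hpρ, hρQ⟩
    · omega
    · by_cases hs : (⟨ρ, hρQ⟩ : Q) ∈ s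
      · have : X ⊆ s.biUnion t := fun x hx =>
          mem_biUnion.2 ⟨_, hs, mem_filter.2 ⟨hx, fun h => (hchild ρ hρQ x hx h).1 rfl⟩⟩
        have := card_le_card this
        omega
      · have : #s < #(univ : Finset Q) :=
          card_lt_card (ssubset_univ_iff.2 fun h => hs (h ▸ mem_univ _))
        simp only [univ_eq_attach, card_attach] at this
        omega
  obtain ⟨g, hginj, hg⟩ := (Finset.all_card_le_biUnion_card_iff_exists_injective t).1 hall
  have hf : ∀ x, ∃ c, (x ∉ W → G.Adj p x → c ∈ W ∧ c ≠ p ∧ ¬ G.Adj x c) ∧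
      ∀ q, g q = x → c = q := by
    intro x
    by_cases h : ∃ q, g q = x
    · obtain ⟨q, rfl⟩ := h
      refine ⟨q, fun _ _ => ?_, fun q' h => by rw [hginj h]⟩
      have h1 := mem_filter.1 (hg q)
      have h2 := mem_filter.1 q.2
      exact ⟨h2.1, h2.2.1, fun h => h1.2 h.symm⟩
    · by_cases hx : x ∉ W
      · obtain ⟨w, hw, hxw⟩ := henc x hx
        refine ⟨w, fun _ hpx => ⟨hw, ?_, hxw⟩, fun q hq => absurd ⟨q, hq⟩ h⟩
        rintro rfl
        exact hxw hpx.symm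
      · exact ⟨x, fun h => absurd h hx, fun q hq => absurd ⟨q, hq⟩ h⟩
  choose f hf1 hf2 using hf
  refine ⟨f, hf1, fun q hqW hqp hpq => ?_⟩
  have hq : q ∈ Q := mem_filter.2 ⟨hqW, hqp, hpq⟩
  have h1 := mem_filter.1 (hg ⟨q, hq⟩)
  have h2 := (mem_filter.1 h1.1).2
  exact ⟨g ⟨q, hq⟩, h2.1, h2.2.1, h2.2.2, hf2 _ _ rfl⟩

/-- In a tree, a set `W` of at least three vertices of degree at least `#W` such that no vertex
outside `W` is adjacent to all of `W` is the set of b-vertices of a b-coloring with colors `W`. -/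
lemma SimpleGraph.IsTree.exists_coloring_of_finset {V : Type*} [Fintype V] {G : SimpleGraph V}
    [DecidableRel G.Adj] (hT : G.IsTree) {W : Finset V} (hW : 3 ≤ #W)
    (hdeg : ∀ w ∈ W, #W ≤ G.degree w) (henc : ∀ u, u ∉ W → ∃ w ∈ W, ¬ G.Adj u w) :
    ∃ C : V → V, (∀ v, C v ∈ W) ∧ (∀ u v, G.Adj u v → C u ≠ C v) ∧ (∀ w ∈ W, C w = w) ∧
      ∀ w ∈ W, ∀ q ∈ W, q ≠ w → ∃ x, G.Adj w x ∧ C x = q := by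
  classical
  obtain ⟨ρ, hρ⟩ : W.Nonempty := card_pos.1 (by omega)
  obtain ⟨par, d, hd, hpar, hadj⟩ := hT.exists_parent_depth ρ
  choose! f hf1 hf2 using fun p (hp : p ∈ W) =>
    exists_child_assignment hadj hdeg henc hρ hp
  -- Colors admissible at a vertex; the root color is avoided far from `W`.
  let P : V → V → Prop := fun v c => c ∈ W ∧ (v ∈ W → c = v) ∧
    (v ∉ W → par v ∈ W → c = f (par v) v) ∧
    (v ∉ W → par v ∉ W → ¬ G.Adj v c ∧ (c = ρ → ∃ w ∈ W, G.Adj v w))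
  have hstep : ∀ v a, v ≠ ρ → P (par v) a → ∃ b, P v b ∧ a ≠ b := by
    rintro v a hv ⟨haW, ha1, ha2, ha3⟩
    have hvp := hpar v hv
    by_cases hvW : v ∈ W
    · refine ⟨v, ⟨hvW, fun _ => rfl, fun h => absurd hvW h, fun h => absurd hvW h⟩, ?_⟩
      rintro rfl
      by_cases hpW : par a ∈ W
      · exact hvp.ne (ha1 hpW)
      · by_cases hppW : par (par a) ∈ W
        · have hpρ : par a ≠ ρ := fun h => hpW (h ▸ hρ)
          have h := (hf1 _ hppW (par a) hpW (hpar _ hpρ).symm).2.2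
          rw [← ha2 hpW hppW] at h
          exact h hvp.symm
        · exact (ha3 hpW hppW).1 hvp.symm
    by_cases hpW : par v ∈ W
    · have h := hf1 _ hpW v hvW hvp.symm
      refine ⟨f (par v) v, ⟨h.1, fun h => absurd h hvW, fun _ _ => rfl,
        fun _ h => absurd hpW h⟩, ?_⟩
      rw [ha1 hpW]
      exact h.2.1.symm
    suffices h : ∃ b ∈ W, a ≠ b ∧ ¬ G.Adj v b ∧ (b = ρ → ∃ w ∈ W, G.Adj v w) by
      obtain ⟨b, hbW, hab, hb⟩ := h
      exact ⟨b, ⟨hbW, fun h => absurd h hvW, fun _ h => absurd h hpW, fun _ _ => hb⟩, hab⟩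
    by_cases hw : ∃ w ∈ W, G.Adj v w
    · by_contra! hcon
      have hall : ∀ b ∈ W, a ≠ b → G.Adj v b := by
        intro b hb hab
        by_contra h
        obtain ⟨-, h'⟩ := hcon b hb hab h
        obtain ⟨w, hwW, hvw⟩ := hw
        exact h' w hwW hvw
      have hvρ : ¬ G.Adj v ρ := by
        intro h
        rcases hadj _ _ h with h | h
        · exact hpW (h.2 ▸ hρ)
        · exact h.1 rfl
      have haρ : a = ρ := by
        by_contra h
        exact hvρ (hall ρ hρ h)
      subst haρ
      have hpρ : par v ≠ a := fun h => hpW (h ▸ hρ)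
      have hdv := hd v hv
      have hdp := hd _ hpρ
      -- No vertex is adjacent to both `v` and its parent.
      have htri : ∀ w, G.Adj (par v) w → ¬ G.Adj v w := by
        intro w h1 h2
        have h3 := hd w
        rcases hadj _ _ h1 with h | h <;> rcases hadj _ _ h2 with h' | h'
        · exact h1.ne h'.2
        · have := h3 h'.1
          rw [h'.2] at this
          rw [h.2] at hdp
          omega
        · exact h1.ne h'.2
        · exact hvp.ne (h'.2.symm.trans h.2)
      by_cases hppW : par (par v) ∈ W
      · have h := hf1 _ hppW (par v) hpW (hpar _ hpρ).symm
        rw [← ha2 hpW hppW] at h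
        exact htri _ (hpar _ hpρ) (hall _ hppW h.2.1)
      · obtain ⟨w, hwW, hpw⟩ := (ha3 hpW hppW).2 rfl
        have hwa : a ≠ w := by
          rintro rfl
          rcases hadj _ _ hpw with h | h
          · exact hppW (h.2 ▸ hρ)
          · exact h.1 rfl
        exact htri w hpw (hall w hwW hwa)
    · obtain ⟨b, hb⟩ : ((W.erase a).erase ρ).Nonempty := by
        apply card_pos.1
        have h1 := pred_card_le_card_erase (s := W) (a := a)
        have h2 := pred_card_le_card_erase (s := W.erase a) (a := ρ)
        omega
      simp only [mem_erase] at hb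
      exact ⟨b, hb.2.2, Ne.symm hb.2.1, fun h => hw ⟨b, hb.2.2, h⟩, fun h => absurd h hb.1⟩
  obtain ⟨C, hC⟩ := exists_coloring_of_parent hd P
    ⟨ρ, hρ, fun _ => rfl, fun h => absurd hρ h, fun h => absurd hρ h⟩ hstep
  have hCW : ∀ w ∈ W, C w = w := fun w hw => (hC w).1.2.1 hw
  refine ⟨C, fun v => (hC v).1.1, fun u v huv => ?_, hCW, fun w hw q hq hqw => ?_⟩
  · rcases hadj _ _ huv with ⟨h, rfl⟩ | ⟨h, rfl⟩
    · exact ((hC u).2 h).symm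
    · exact (hC v).2 h
  · by_cases hwq : G.Adj w q
    · exact ⟨q, hwq, hCW q hq⟩
    · obtain ⟨x, hxW, hxρ, rfl, rfl⟩ := hf2 w hw q hq hqw hwq
      exact ⟨x, (hpar x hxρ).symm, (hC x).1.2.2.1 hxW hw⟩

/-- Among `k` vertices of degree at least `k` of a triangle-free graph, one can
exchange a vertex so that no outside vertex is adjacent to all `k` of them. -/
lemma exists_finset_card_eq_forall_exists_not_adj {V : Type*} [Fintype V] {G : SimpleGraph V}
    [DecidableRel G.Adj] (hG : ∀ u v w, G.Adj u v → G.Adj v w → ¬ G.Adj u w) {k : ℕ} (hk : 2 ≤ k)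
    (h : k ≤ #(univ.filter fun v => k ≤ G.degree v)) :
    ∃ W : Finset V, #W = k ∧ (∀ w ∈ W, k ≤ G.degree w) ∧
      ∀ u, u ∉ W → ∃ w ∈ W, ¬ G.Adj u w := by
  classical
  obtain ⟨W, hWS, hW⟩ := exists_subset_card_eq h
  have hdeg : ∀ w ∈ W, k ≤ G.degree w := fun w hw => (mem_filter.1 (hWS hw)).2
  by_cases hu : ∀ u, u ∉ W → ∃ w ∈ W, ¬ G.Adj u w
  · exact ⟨W, hW, hdeg, hu⟩
  push Not at hu
  obtain ⟨u, huW, hu⟩ := hu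
  obtain ⟨a, b, ha, hb, hab⟩ := one_lt_card_iff.1 (show 1 < #W by omega)
  refine ⟨insert u (W.erase a), ?_, fun w hw => ?_, fun z _ => ?_⟩
  · rw [card_insert_of_notMem fun h => huW (mem_of_mem_erase h), card_erase_of_mem ha]
    omega
  · rcases mem_insert.1 hw with rfl | hw
    · rw [← card_neighborFinset_eq_degree, ← hW]
      exact card_le_card fun x hx => (G.mem_neighborFinset _ _).2 (hu x hx)
    · exact hdeg w (mem_of_mem_erase hw)
  · by_contra! hz
    exact hG z u b (hz u (mem_insert_self _ _)) (hu b hb)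
      (hz b (mem_insert_of_mem (mem_erase.2 ⟨hab.symm, hb⟩)))

/-- A tree with `k ≥ 3` vertices of degree at least `k` has a b-coloring with `k` colors. -/
lemma SimpleGraph.IsTree.exists_isBColoring {V : Type*} [Fintype V] {G : SimpleGraph V}
    [DecidableRel G.Adj] (hT : G.IsTree) {k : ℕ} (hk : 3 ≤ k)
    (h : k ≤ #(univ.filter fun v => k ≤ G.degree v)) :
    ∃ C : V → Fin k, IsBColoring G k C := by
  classical
  have htri : ∀ u v w, G.Adj u v → G.Adj v w → ¬ G.Adj u w := fun u v w huv hvw huw =>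
    hT.isAcyclic.cliqueFree le_rfl {u, v, w} (is3Clique_triple_iff.2 ⟨huv, huw, hvw⟩)
  obtain ⟨W, rfl, hdeg, henc⟩ :=
    exists_finset_card_eq_forall_exists_not_adj htri (by omega) h
  obtain ⟨C, hCW, hC, hCid, hCb⟩ := hT.exists_coloring_of_finset hk hdeg henc
  refine ⟨fun v => W.equivFin ⟨C v, hCW v⟩, fun u v huv heq => hC u v huv ?_, fun i => ?_⟩
  · simpa using heq
  · obtain ⟨⟨w, hw⟩, rfl⟩ := W.equivFin.surjective i
    refine ⟨w, by simp [hCid w hw], fun j hj => ?_⟩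
    obtain ⟨⟨q, hq⟩, rfl⟩ := W.equivFin.surjective j
    obtain ⟨x, hwx, rfl⟩ := hCb w hw q hq (by rintro rfl; exact hj (by simp [hCid q hw]))
    exact ⟨x, hwx, rfl⟩

/-- A tree with an edge has a b-coloring with two colors. -/
lemma SimpleGraph.IsTree.exists_isBColoring_two {V : Type*} {G : SimpleGraph V}
    (hT : G.IsTree) {u v : V} (huv : G.Adj u v) : ∃ C : V → Fin 2, IsBColoring G 2 C := by
  let C := hT.coloringTwo
  have hC : C u ≠ C v := C.valid huv
  refine ⟨C, fun a b hab => C.valid hab, fun i => ?_⟩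
  by_cases hi : C u = i
  · exact ⟨u, hi, fun j hj => ⟨v, huv, by change j ≠ C u at hj; omega⟩⟩
  · exact ⟨v, by omega, fun j hj => ⟨u, huv.symm, by change j ≠ C v at hj; omega⟩⟩

/-- A b-coloring with `k` colors provides `k` vertices of degree at least `k - 1`. -/
lemma IsBColoring.le_card {V : Type*} [Fintype V] {G : SimpleGraph V} [DecidableRel G.Adj]
    {k : ℕ} {C : V → Fin k} (hC : IsBColoring G k C) :
    k ≤ #(univ.filter fun v => k - 1 ≤ G.degree v) := by
  classical
  choose u hu hub using hC.2
  have hinj : Function.Injective u := fun i j h => by rw [← hu i, ← hu j, h]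
  have hcard : #(univ.image u) = k := by simp [card_image_of_injective _ hinj]
  refine hcard.symm.trans_le (card_le_card fun v hv => ?_)
  obtain ⟨i, -, rfl⟩ := mem_image.1 hv
  refine mem_filter.2 ⟨mem_univ _, ?_⟩
  have hsub : univ.erase i ⊆ (G.neighborFinset (u i)).image C := by
    intro j hj
    obtain ⟨w, hw, rfl⟩ := hub i j (by rw [hu]; exact ne_of_mem_erase hj)
    exact mem_image_of_mem _ ((G.mem_neighborFinset _ _).2 hw)
  have := (card_le_card hsub).trans card_image_le
  simpa using this

lemma bddAbove_mParam {V : Type*} [Fintype V] (G : SimpleGraph V) [DecidableRel G.Adj] :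
    BddAbove {k : ℕ | k ≤ #(univ.filter fun v => k - 1 ≤ G.degree v)} :=
  ⟨Fintype.card V, fun _ hk => hk.trans (card_le_univ _)⟩

/-- If `G` is a finite tree, then `χ_b(G)` equals `m(G)` or `m(G) - 1`. -/
theorem bChromatic_of_tree {V : Type*} [Fintype V] (G : SimpleGraph V)
    [DecidableRel G.Adj] (hT : G.IsTree) :
    bChromatic G = mParam G ∨ bChromatic G = mParam G - 1 := by
  have hle : ∀ k, (∃ C : V → Fin k, IsBColoring G k C) → k ≤ mParam G := fun k ⟨_, hC⟩ =>
    le_csSup (bddAbove_mParam G) hC.le_card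
  have hge : ∀ k, (∃ C : V → Fin k, IsBColoring G k C) → k ≤ bChromatic G := fun k hk =>
    le_csSup ⟨mParam G, fun k hk => hle k hk⟩ hk
  have hub : bChromatic G ≤ mParam G := csSup_le' fun k hk => hle k hk
  have hm : mParam G ≤ #(univ.filter fun v => mParam G - 1 ≤ G.degree v) :=
    Nat.sSup_mem ⟨0, by simp⟩ (bddAbove_mParam G)
  suffices mParam G - 1 ≤ bChromatic G by omega
  rcases lt_or_ge (mParam G) 2 with h2 | h2
  · omega
  rcases lt_or_ge (mParam G) 4 with h4 | h4
  · obtain ⟨v, hv⟩ := card_pos.1 ((Nat.zero_lt_of_lt h2).trans_le hm)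
    have hv := (mem_filter.1 hv).2
    obtain ⟨w, hw⟩ := (G.degree_pos_iff_exists_adj v).1 (by omega)
    have := hge 2 (hT.exists_isBColoring_two hw)
    omega
  · exact hge _ (hT.exists_isBColoring (by omega) ((Nat.sub_le _ _).trans hm))
end

section
/- Let G be a finite simple graph. If |M(G)| = m(G) and M(G) encircles some vertex of V(G)\M(G), then G has no b-coloring with m(G) colors; hence χ_b(G) ≤ m(G) - 1. -/
open SimpleGraph Finset

/-- A b-vertex sees every color other than its own. -/
theorem IsBVertex.erase_subset_image {V : Type*} [Fintype V] {G : SimpleGraph V}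
    [DecidableRel G.Adj] {k : ℕ} {C : V → Fin k} {u : V} (h : IsBVertex G C u) :
    Finset.univ.erase (C u) ⊆ (G.neighborFinset u).image C := by
  intro j hj
  obtain ⟨w, hw, rfl⟩ := h j (Finset.ne_of_mem_erase hj)
  exact Finset.mem_image_of_mem C ((G.mem_neighborFinset u w).2 hw)

theorem IsBVertex.le_card_image {V : Type*} [Fintype V] {G : SimpleGraph V}
    [DecidableRel G.Adj] {k : ℕ} {C : V → Fin k} {u : V} (h : IsBVertex G C u) :
    k - 1 ≤ ((G.neighborFinset u).image C).card := by
  simpa using Finset.card_le_card h.erase_subset_image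

theorem IsBVertex.le_degree {V : Type*} [Fintype V] {G : SimpleGraph V}
    [DecidableRel G.Adj] {k : ℕ} {C : V → Fin k} {u : V} (h : IsBVertex G C u) :
    k - 1 ≤ G.degree u :=
  h.le_card_image.trans Finset.card_image_le

/-- A b-vertex of degree `k - 1` sees every color at most once. -/
theorem IsBVertex.eq_of_adj {V : Type*} [Fintype V] {G : SimpleGraph V}
    [DecidableRel G.Adj] {k : ℕ} {C : V → Fin k} {w : V} (h : IsBVertex G C w)
    (hdeg : G.degree w = k - 1) {u v : V} (hu : G.Adj w u) (hv : G.Adj w v)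
    (huv : C u = C v) : u = v := by
  have hcard : ((G.neighborFinset w).image C).card = (G.neighborFinset w).card :=
    le_antisymm Finset.card_image_le
      ((G.card_neighborFinset_eq_degree w).trans hdeg ▸ h.le_card_image)
  exact Finset.card_image_iff.1 hcard (by simpa using hu) (by simpa using hv) huv

theorem IsBColoring.le_mParam {V : Type*} [Fintype V] {G : SimpleGraph V}
    [DecidableRel G.Adj] {k : ℕ} {C : V → Fin k} (h : IsBColoring G k C) :
    k ≤ mParam G := by
  choose b hbC hb using h.2
  refine le_csSup ⟨Fintype.card V, fun j hj => le_trans hj (Finset.card_le_univ _)⟩ ?_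
  have hinj : Function.Injective b := Function.LeftInverse.injective hbC
  simpa using Finset.card_le_card_of_injOn (s := Finset.univ)
    (t := Finset.univ.filter fun v => k - 1 ≤ G.degree v) b
    (fun i _ => by simpa using (hb i).le_degree) hinj.injOn

/-- If there are exactly `m(G)` dense vertices, then in a b-coloring with `m(G)` colors they are
all b-vertices. -/
theorem IsBColoring.isBVertex_of_mem_denseSet {V : Type*} [Fintype V] {G : SimpleGraph V}
    [DecidableRel G.Adj] (hcard : (denseSet G).card = mParam G) {C : V → Fin (mParam G)}
    (h : IsBColoring G (mParam G) C) {w : V} (hw : w ∈ denseSet G) : IsBVertex G C w := by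
  choose b hbC hb using h.2
  have hinj : Function.Injective b := Function.LeftInverse.injective hbC
  obtain ⟨i, -, rfl⟩ := Finset.surjOn_of_injOn_of_card_le (s := Finset.univ) (t := denseSet G) b
    (fun i _ => by simpa [denseSet] using (hb i).le_degree) hinj.injOn (by simp [hcard]) hw
  exact hb i

/-- If `|M(G)| = m(G)` and `M(G)` encircles some vertex outside `M(G)`, then `G` has no
b-coloring with `m(G)` colors; hence `χ_b(G) ≤ m(G) - 1`. -/
theorem no_bColoring_of_denseSet_encircles {V : Type*} [Fintype V] (G : SimpleGraph V)
    [DecidableRel G.Adj] (hcard : (denseSet G).card = mParam G)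
    (henc : ∃ u, u ∉ denseSet G ∧ Encircles G (denseSet G) u) :
    (¬ ∃ C : V → Fin (mParam G), IsBColoring G (mParam G) C) ∧
      bChromatic G ≤ mParam G - 1 := by
  have hno : ¬ ∃ C : V → Fin (mParam G), IsBColoring G (mParam G) C := by
    rintro ⟨C, hC⟩
    obtain ⟨u, hu, henc⟩ := henc
    obtain ⟨v, hvC, hv⟩ := hC.2 (C u)
    have hvM : v ∈ denseSet G := by simpa [denseSet] using hv.le_degree
    rcases henc v hvM with hadj | ⟨w, hw, hvw, huw, hdeg⟩
    · exact hC.1 u v hadj hvC.symm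
    · exact hu ((hC.isBVertex_of_mem_denseSet hcard hw).eq_of_adj hdeg huw.symm hvw.symm
        hvC.symm ▸ hvM)
  refine ⟨hno, csSup_le' ?_⟩
  rintro k ⟨C, hC⟩
  have hne : k ≠ mParam G := by
    rintro rfl
    exact hno ⟨C, hC⟩
  have := hC.le_mParam
  lia
end

section
/- Let G be a finite simple graph, k a positive integer, and W = {v_1, …, v_k} a set of k distinct vertices of G. Suppose there is a proper coloring with colors {1, …, k} of the subgraph of G induced by W together with all neighbors of vertices of W, such that each v_i receives color i and each v_i has, among its neighbors, vertices of all colors in {1, …, k} other than i. Suppose furthermore that every vertex of G of degree at least k lies in W or is adjacent to a vertex of W. Then G has a b-coloring with k colors. -/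
open SimpleGraph Finset

/-- Greedy extension: a coloring that is proper on `S` can be changed outside `S` to a proper
coloring of all of `G` when every vertex outside `S` has degree less than the number of colors. -/
theorem exists_proper_extension {V : Type*} [Fintype V] (G : SimpleGraph V)
    [DecidableRel G.Adj] {k : ℕ} (S : Set V) (C₀ : V → Fin k)
    (hproper : ∀ x ∈ S, ∀ y ∈ S, G.Adj x y → C₀ x ≠ C₀ y)
    (hdeg : ∀ x ∉ S, G.degree x < k) :
    ∃ C : V → Fin k, (∀ x ∈ S, C x = C₀ x) ∧ ∀ x y, G.Adj x y → C x ≠ C y := by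
  classical
  suffices h : ∀ T : Finset V, ∃ C : V → Fin k, (∀ x ∈ S, C x = C₀ x) ∧
      ∀ x ∈ S ∪ T, ∀ y ∈ S ∪ T, G.Adj x y → C x ≠ C y by
    obtain ⟨C, hC, hp⟩ := h Finset.univ
    exact ⟨C, hC, fun x y => hp x (by simp) y (by simp)⟩
  intro T
  induction T using Finset.induction_on with
  | empty => exact ⟨C₀, fun _ _ => rfl, by simpa using hproper⟩
  | insert a T _ ih =>
    obtain ⟨C, hC, hp⟩ := ih
    by_cases haS : a ∈ S
    · refine ⟨C, hC, fun x hx y hy => hp x ?_ y ?_⟩ <;> grind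
    · obtain ⟨c, hc⟩ : ∃ c, c ∉ (G.neighborFinset a).image C := by
        by_contra! hall
        have huniv : (G.neighborFinset a).image C = Finset.univ :=
          Finset.eq_univ_of_forall hall
        have hle := Finset.card_image_le (s := G.neighborFinset a) (f := C)
        rw [huniv, Finset.card_univ, Fintype.card_fin, G.card_neighborFinset_eq_degree] at hle
        exact (hdeg a haS).not_ge hle
      have hfree : ∀ y, G.Adj a y → C y ≠ c := fun y hy h =>
        hc (Finset.mem_image.2 ⟨y, by simpa using hy, h⟩)
      refine ⟨Function.update C a c, fun x hx => ?_, fun x hx y hy hxy => ?_⟩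
      · rw [Function.update_of_ne (ne_of_mem_of_not_mem hx haS), hC x hx]
      · have hne := hxy.ne
        have hsymm := hxy.symm
        simp only [Function.update_apply]
        grind

/-- If a partial proper coloring of `W ∪ N(W)` with `k` colors makes each `v i` a vertex of
color `i` seeing all other colors, and every vertex of degree at least `k` lies in `W` or is
adjacent to `W`, then `G` has a b-coloring with `k` colors. -/
theorem bColoring_of_partial_coloring {V : Type*} [Fintype V] (G : SimpleGraph V)
    [DecidableRel G.Adj] (k : ℕ) (hk : 0 < k) (v : Fin k → V) (hv : Function.Injective v)
    (C₀ : V → Fin k)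
    (hproper : ∀ x y, x ∈ Set.range v ∪ {z | ∃ i, G.Adj (v i) z} →
      y ∈ Set.range v ∪ {z | ∃ i, G.Adj (v i) z} → G.Adj x y → C₀ x ≠ C₀ y)
    (hcol : ∀ i : Fin k, C₀ (v i) = i)
    (hsees : ∀ i j : Fin k, j ≠ i → ∃ w, G.Adj (v i) w ∧ C₀ w = j)
    (hdeg : ∀ x : V, k ≤ G.degree x → (∃ i, x = v i) ∨ ∃ i, G.Adj (v i) x) :
    ∃ C : V → Fin k, IsBColoring G k C := by
  obtain ⟨C, hC, hp⟩ := exists_proper_extension G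
    (Set.range v ∪ {z | ∃ i, G.Adj (v i) z}) C₀ (fun x hx y hy => hproper x y hx hy)
    (fun x hx => by
      by_contra! hlt
      refine hx ((hdeg x hlt).imp ?_ id)
      rintro ⟨i, rfl⟩
      exact ⟨i, rfl⟩)
  have hCv : ∀ i, C (v i) = i := fun i => (hC _ (Or.inl ⟨i, rfl⟩)).trans (hcol i)
  refine ⟨C, hp, fun i => ⟨v i, hCv i, fun j hj => ?_⟩⟩
  obtain ⟨w, hw, hwj⟩ := hsees i j (hCv i ▸ hj)
  exact ⟨w, hw, (hC w (Or.inr ⟨i, hw⟩)).trans hwj⟩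
end
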